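/- arXiv:2005.05951 — 3 statements merged into one kernel-verified Lean document; each statement's English description precedes it below -/
import Mathlib

section
/- (Theorem 1, lower bound.) Let M be an MDP with rewards bounded in [−Rmax, Rmax] and discount γ ∈ [0,1), let P̂ be an approximate transition kernel, let U be the set of α-unknown state-action pairs, and let M̂_p be the (α, Rmax)-pessimistic MDP built from P̂, U and an estimated initial distribution ρ̂0. Then for every policy π: J_{ρ̂0}(π, M̂_p) ≥ J_{ρ0}(π, M) − (2·Rmax/(1−γ))·D_TV(ρ0, ρ̂0) − (2·γ·Rmax/(1−γ)²)·α − (2·Rmax/(1−γ))·E[γ^{T_U^π}], where T_U^π is the hitting time of U by π on M. -/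
open scoped ENNReal NNReal
open Classical

namespace MOReL

universe u v

variable {S : Type u} {A : Type v}

/-- Distribution over trajectory prefixes `(s_0,a_0),…,(s_n,a_n)` generated by executing
policy `π` in the MDP with transition kernel `P` starting from `ρ0`. -/
noncomputable def pathPMF (ρ0 : PMF S) (π : S → PMF A) (P : S → A → PMF S) :
    (n : ℕ) → PMF (Fin (n + 1) → S × A)
  | 0 => ρ0.bind fun s => (π s).map fun a => fun _ => (s, a)
  | n + 1 =>
      (pathPMF ρ0 π P n).bind fun p =>
        (P (p (Fin.last n)).1 (p (Fin.last n)).2).bind fun s' =>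
          (π s').map fun a' => Fin.snoc p (s', a')

/-- Marginal distribution of `(s_t, a_t)`. -/
noncomputable def saDist (ρ0 : PMF S) (π : S → PMF A) (P : S → A → PMF S) (t : ℕ) :
    PMF (S × A) :=
  (pathPMF ρ0 π P t).map fun p => p (Fin.last t)

/-- Expectation of a real-valued function under a PMF. -/
noncomputable def pexp {α : Type*} (μ : PMF α) (f : α → ℝ) : ℝ :=
  ∑' x, (μ x).toReal * f x

/-- The value `J_{ρ0}(π, M) = E[∑_t γ^t r(s_t,a_t)]`. -/
noncomputable def J (ρ0 : PMF S) (π : S → PMF A) (P : S → A → PMF S) (γ : ℝ)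
    (r : S → A → ℝ) : ℝ :=
  ∑' t : ℕ, γ ^ t * pexp (saDist ρ0 π P t) (fun sa => r sa.1 sa.2)

/-- `P(T_V^π = t)`: the probability that the first visit of the executed trajectory to the
state-action set `V` occurs at time `t`. -/
noncomputable def hitProb (ρ0 : PMF S) (π : S → PMF A) (P : S → A → PMF S)
    (V : Set (S × A)) (t : ℕ) : ℝ≥0∞ :=
  (pathPMF ρ0 π P t).toOuterMeasure
    {p | p (Fin.last t) ∈ V ∧ ∀ i : Fin (t + 1), (i : ℕ) < t → p i ∉ V}

/-- `E[γ^{T_V^π}]`, with the convention `γ^∞ = 0`. -/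
noncomputable def discHit (ρ0 : PMF S) (π : S → PMF A) (P : S → A → PMF S) (γ : ℝ)
    (V : Set (S × A)) : ℝ :=
  ∑' t : ℕ, γ ^ t * (hitProb ρ0 π P V t).toReal

/-- Total variation distance between two PMFs. -/
noncomputable def DTV {α : Type*} (p q : PMF α) : ℝ :=
  (1 / 2) * ∑' x, |(p x).toReal - (q x).toReal|

/-- Discounted state-action visitation distribution `d^{π,M}(s,a)`. -/
noncomputable def dVisit (ρ0 : PMF S) (π : S → PMF A) (P : S → A → PMF S) (γ : ℝ)
    (sa : S × A) : ℝ :=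
  (1 - γ) * ∑' t : ℕ, γ ^ t * ((saDist ρ0 π P t) sa).toReal

/-- `d^{π,M}(V)` for a set `V` of state-action pairs. -/
noncomputable def dVisitSet (ρ0 : PMF S) (π : S → PMF A) (P : S → A → PMF S) (γ : ℝ)
    (V : Set (S × A)) : ℝ :=
  ∑' sa : V, dVisit ρ0 π P γ sa

/-- The set of `α`-unknown state-action pairs. -/
def unknown (P Phat : S → A → PMF S) (α : ℝ) : Set (S × A) :=
  {sa | α < DTV (Phat sa.1 sa.2) (P sa.1 sa.2)}

/-- Transition kernel of the pessimistic MDP on `Option S` (`none` is the absorbing state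
HALT): unknown pairs and HALT transition to HALT, known pairs follow `Phat`. -/
noncomputable def pessKernel (Phat : S → A → PMF S) (U : Set (S × A)) :
    Option S → A → PMF (Option S) := fun s a =>
  match s with
  | none => PMF.pure none
  | some s => if (s, a) ∈ U then PMF.pure none else (Phat s a).map some

/-- Reward of the pessimistic MDP: `-κ` at HALT and `r` elsewhere. -/
def pessReward (r : S → A → ℝ) (κ : ℝ) : Option S → A → ℝ := fun s a =>
  match s with
  | none => -κ
  | some s => r s a

/-- Extend a policy on `S` to `Option S` by an arbitrary action distribution at HALT
(the pessimistic value does not depend on this choice). -/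
def extendPolicy (π : S → PMF A) (a0 : PMF A) : Option S → PMF A := fun s =>
  match s with
  | none => a0
  | some s => π s

end MOReL

namespace MOReL

section Expectation

variable {X Y : Type*}

/-- A real-valued function is bounded. -/
def Bounded (f : X → ℝ) : Prop := ∃ C, ∀ x, |f x| ≤ C

theorem Bounded.const (c : ℝ) : Bounded (fun _ : X => c) := ⟨|c|, fun _ => le_rfl⟩

theorem Bounded.add {f g : X → ℝ} (hf : Bounded f) (hg : Bounded g) :
    Bounded fun x => f x + g x := by
  obtain ⟨C, hC⟩ := hf
  obtain ⟨D, hD⟩ := hg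
  exact ⟨C + D, fun x => (abs_add_le _ _).trans (add_le_add (hC x) (hD x))⟩

theorem Bounded.mul {f g : X → ℝ} (hf : Bounded f) (hg : Bounded g) :
    Bounded fun x => f x * g x := by
  obtain ⟨C, hC⟩ := hf
  obtain ⟨D, hD⟩ := hg
  refine ⟨C * D, fun x => ?_⟩
  rw [abs_mul]
  exact mul_le_mul (hC x) (hD x) (abs_nonneg _) ((abs_nonneg _).trans (hC x))

theorem Bounded.comp {f : X → ℝ} (hf : Bounded f) (g : Y → X) : Bounded fun y => f (g y) := by
  obtain ⟨C, hC⟩ := hf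
  exact ⟨C, fun y => hC (g y)⟩

theorem hasSum_toReal (μ : PMF X) : HasSum (fun x => (μ x).toReal) 1 := by
  have h : ∑' x, μ x ≠ ∞ := μ.tsum_coe_ne_top
  have h' := ENNReal.hasSum_toReal h
  rwa [← ENNReal.tsum_toReal_eq μ.apply_ne_top, μ.tsum_coe, ENNReal.toReal_one] at h'

theorem Bounded.summable_pexp {f : X → ℝ} (hf : Bounded f) (μ : PMF X) :
    Summable fun x => (μ x).toReal * f x := by
  obtain ⟨C, hC⟩ := hf
  refine Summable.of_norm_bounded ((hasSum_toReal μ).summable.mul_right C) fun x => ?_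
  rw [Real.norm_eq_abs, abs_mul, abs_of_nonneg ENNReal.toReal_nonneg]
  exact mul_le_mul_of_nonneg_left (hC x) ENNReal.toReal_nonneg

theorem pexp_const (μ : PMF X) (c : ℝ) : pexp μ (fun _ => c) = c := by
  simp [pexp, tsum_mul_right, (hasSum_toReal μ).tsum_eq]

theorem pexp_const_mul (μ : PMF X) (c : ℝ) (f : X → ℝ) :
    pexp μ (fun x => c * f x) = c * pexp μ f := by
  simp only [pexp, mul_left_comm _ c, tsum_mul_left]

theorem pexp_add (μ : PMF X) {f g : X → ℝ} (hf : Bounded f) (hg : Bounded g) :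
    pexp μ (fun x => f x + g x) = pexp μ f + pexp μ g := by
  simp only [pexp, mul_add]
  exact (hf.summable_pexp μ).tsum_add (hg.summable_pexp μ)

theorem pexp_mono (μ : PMF X) {f g : X → ℝ} (hf : Bounded f) (hg : Bounded g)
    (h : ∀ x, f x ≤ g x) : pexp μ f ≤ pexp μ g :=
  (hf.summable_pexp μ).tsum_le_tsum
    (fun x => mul_le_mul_of_nonneg_left (h x) ENNReal.toReal_nonneg) (hg.summable_pexp μ)

theorem abs_pexp_le (μ : PMF X) {f : X → ℝ} {C : ℝ} (hC : ∀ x, |f x| ≤ C) :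
    |pexp μ f| ≤ C := by
  have hf : Bounded f := ⟨C, hC⟩
  rw [abs_le]
  constructor
  · rw [← pexp_const μ (-C)]
    exact pexp_mono μ (.const _) hf fun x => (abs_le.1 (hC x)).1
  · rw [← pexp_const μ C]
    exact pexp_mono μ hf (.const _) fun x => (abs_le.1 (hC x)).2

theorem Bounded.pexp {f : X × Y → ℝ} (hf : Bounded f) (μ : X → PMF Y) :
    Bounded fun x => pexp (μ x) fun y => f (x, y) := by
  obtain ⟨C, hC⟩ := hf
  exact ⟨C, fun x => abs_pexp_le _ fun y => hC (x, y)⟩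

theorem pexp_pure (x : X) (f : X → ℝ) : pexp (PMF.pure x) f = f x := by
  rw [MOReL.pexp, tsum_eq_single x]
  · simp
  · intro y hy
    simp [PMF.pure_apply, hy]

theorem pexp_bind (p : PMF X) (q : X → PMF Y) {f : Y → ℝ} (hf : Bounded f) :
    pexp (p.bind q) f = pexp p fun x => pexp (q x) f := by
  have hw : Summable fun z : X × Y => (p z.1).toReal * (q z.1 z.2).toReal := by
    have h0 : ∀ z : X × Y, 0 ≤ (p z.1).toReal * (q z.1 z.2).toReal := by
      intro z
      positivity
    refine (summable_prod_of_nonneg h0).2 ⟨fun x => ?_, ?_⟩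
    · have h := (hasSum_toReal (q x)).summable.mul_left (p x).toReal
      exact h
    · simp only [tsum_mul_left, (hasSum_toReal (q _)).tsum_eq, mul_one]
      exact (hasSum_toReal p).summable
  have hs : Summable fun z : X × Y => (p z.1).toReal * (q z.1 z.2).toReal * f z.2 := by
    obtain ⟨C, hC⟩ := hf
    refine Summable.of_norm_bounded (hw.mul_right C) fun z => ?_
    rw [Real.norm_eq_abs, abs_mul, abs_of_nonneg (by positivity)]
    exact mul_le_mul_of_nonneg_left (hC z.2) (by positivity)
  have hb : ∀ y, ((p.bind q) y).toReal = ∑' x, (p x).toReal * (q x y).toReal := by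
    intro y
    rw [PMF.bind_apply, ENNReal.tsum_toReal_eq]
    · simp only [ENNReal.toReal_mul]
    · exact fun x => ENNReal.mul_ne_top (p.apply_ne_top x) ((q x).apply_ne_top y)
  simp only [MOReL.pexp, hb, ← tsum_mul_left, ← tsum_mul_right, ← mul_assoc]
  exact hs.tsum_comm

theorem pexp_map (p : PMF X) (g : X → Y) {f : Y → ℝ} (hf : Bounded f) :
    pexp (p.map g) f = pexp p fun x => f (g x) := by
  rw [← PMF.bind_pure_comp, pexp_bind _ _ hf]
  simp only [Function.comp_apply, pexp_pure]

theorem abs_pexp_sub_pexp_le (p q : PMF X) {f : X → ℝ} {C : ℝ} (hC : ∀ x, |f x| ≤ C) :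
    |pexp p f - pexp q f| ≤ 2 * C * DTV p q := by
  have hf : Bounded f := ⟨C, hC⟩
  have hd : Summable fun x => |(p x).toReal - (q x).toReal| :=
    ((hasSum_toReal p).summable.sub (hasSum_toReal q).summable).abs
  have e : pexp p f - pexp q f = ∑' x, ((p x).toReal - (q x).toReal) * f x := by
    simp only [sub_mul]
    exact ((hf.summable_pexp p).tsum_sub (hf.summable_pexp q)).symm
  rw [e, ← Real.norm_eq_abs]
  refine (tsum_of_norm_bounded (hd.mul_left C).hasSum fun x => ?_).trans (le_of_eq ?_)
  · rw [Real.norm_eq_abs, abs_mul, mul_comm]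
    exact mul_le_mul_of_nonneg_right (hC x) (abs_nonneg _)
  · rw [tsum_mul_left, DTV]
    ring

theorem toReal_toOuterMeasure (μ : PMF X) (s : Set X) :
    (μ.toOuterMeasure s).toReal = pexp μ fun x => if x ∈ s then 1 else 0 := by
  rw [PMF.toOuterMeasure_apply, ENNReal.tsum_toReal_eq, pexp]
  · refine tsum_congr fun x => ?_
    by_cases hx : x ∈ s <;> simp [hx]
  · intro x
    by_cases hx : x ∈ s <;> simp [hx, μ.apply_ne_top]

end Expectation

section Backup

variable {S : Type*} {A : Type*}

/-- Expectation of `f (s, a)` when `s` is drawn from `μ` and `a` from the policy. -/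
noncomputable def stepExp (π : S → PMF A) (μ : PMF S) (f : S × A → ℝ) : ℝ :=
  pexp μ fun s => pexp (π s) fun a => f (s, a)

theorem stepExp_add (π : S → PMF A) (μ : PMF S) {f g : S × A → ℝ} (hf : Bounded f)
    (hg : Bounded g) : stepExp π μ (fun x => f x + g x) = stepExp π μ f + stepExp π μ g := by
  rw [stepExp, stepExp, stepExp, ← pexp_add μ (hf.pexp π) (hg.pexp π)]
  congr 1
  funext s
  exact pexp_add _ (hf.comp _) (hg.comp _)

theorem stepExp_const_mul (π : S → PMF A) (μ : PMF S) (c : ℝ) (f : S × A → ℝ) :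
    stepExp π μ (fun x => c * f x) = c * stepExp π μ f := by
  simp only [stepExp, pexp_const_mul]

theorem stepExp_const (π : S → PMF A) (μ : PMF S) (c : ℝ) :
    stepExp π μ (fun _ => c) = c := by
  simp only [stepExp, pexp_const]

theorem stepExp_mono (π : S → PMF A) (μ : PMF S) {f g : S × A → ℝ} (hf : Bounded f)
    (hg : Bounded g) (h : ∀ x, f x ≤ g x) : stepExp π μ f ≤ stepExp π μ g :=
  pexp_mono μ (hf.pexp π) (hg.pexp π) fun _ =>
    pexp_mono _ (hf.comp _) (hg.comp _) fun _ => h _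

theorem abs_stepExp_le (π : S → PMF A) (μ : PMF S) {f : S × A → ℝ} {C : ℝ}
    (hC : ∀ x, |f x| ≤ C) : |stepExp π μ f| ≤ C :=
  abs_pexp_le _ fun _ => abs_pexp_le _ fun _ => hC _

theorem abs_stepExp_sub_le (π : S → PMF A) (μ ν : PMF S) {f : S × A → ℝ} {C : ℝ}
    (hC : ∀ x, |f x| ≤ C) : |stepExp π μ f - stepExp π ν f| ≤ 2 * C * DTV μ ν :=
  abs_pexp_sub_pexp_le _ _ fun _ => abs_pexp_le _ fun _ => hC _

/-- One-step expectation operator of the chain on state-action pairs, weighted by `c`. -/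
noncomputable def backup (π : S → PMF A) (P : S → A → PMF S) (c f : S × A → ℝ) :
    S × A → ℝ := fun x => c x * stepExp π (P x.1 x.2) f

theorem Bounded.backup {c f : S × A → ℝ} (hc : Bounded c) (hf : Bounded f) (π : S → PMF A)
    (P : S → A → PMF S) : Bounded (backup π P c f) := by
  obtain ⟨C, hC⟩ := hf
  exact hc.mul ⟨C, fun x => abs_stepExp_le π _ hC⟩

/-- The `n`-step discounted sum of `f` along the chain weighted by `c`, as a function of the
starting state-action pair. -/
noncomputable def qSum (π : S → PMF A) (P : S → A → PMF S) (γ : ℝ) (c f : S × A → ℝ) :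
    ℕ → S × A → ℝ
  | 0 => fun _ => 0
  | n + 1 => fun x => f x + γ * backup π P c (qSum π P γ c f n) x

theorem Bounded.qSum {c f : S × A → ℝ} (hc : Bounded c) (hf : Bounded f) (π : S → PMF A)
    (P : S → A → PMF S) (γ : ℝ) (n : ℕ) : Bounded (qSum π P γ c f n) := by
  induction n with
  | zero => exact .const 0
  | succ n ih => exact hf.add ((Bounded.const γ).mul (hc.backup ih π P))

theorem qSum_succ' {c f : S × A → ℝ} (hc : Bounded c) (hf : Bounded f) (π : S → PMF A)
    (P : S → A → PMF S) (γ : ℝ) (n : ℕ) (x : S × A) :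
    qSum π P γ c f (n + 1) x = f x + γ * qSum π P γ c (backup π P c f) n x := by
  induction n generalizing x with
  | zero => simp [qSum, backup, stepExp_const]
  | succ n ih =>
    have hL := hc.backup hf π P
    rw [qSum, funext ih]
    conv_rhs => rw [qSum]
    simp only [backup]
    rw [stepExp_add π _ hf ((Bounded.const γ).mul (hc.qSum hL π P γ n)), stepExp_const_mul]
    ring

/-- Expectation of `f` at the last pair of the length-`n` trajectory, weighted by the product
of `c` over the preceding pairs. -/
noncomputable def weightedExp (ρ : PMF S) (π : S → PMF A) (P : S → A → PMF S)
    (c f : S × A → ℝ) (n : ℕ) : ℝ :=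
  pexp (pathPMF ρ π P n) fun p => (∏ i : Fin n, c (p i.castSucc)) * f (p (Fin.last n))

theorem bounded_path {c f : S × A → ℝ} (hc : Bounded c) (hf : Bounded f) (n : ℕ) :
    Bounded fun p : Fin (n + 1) → S × A =>
      (∏ i : Fin n, c (p i.castSucc)) * f (p (Fin.last n)) := by
  obtain ⟨C, hC⟩ := hc
  refine Bounded.mul ⟨C ^ n, fun p => ?_⟩ (hf.comp _)
  rw [Finset.abs_prod]
  refine (Finset.prod_le_prod (fun _ _ => abs_nonneg _) fun i _ => hC _).trans ?_
  simp

theorem weightedExp_zero (ρ : PMF S) (π : S → PMF A) (P : S → A → PMF S) (c : S × A → ℝ)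
    {f : S × A → ℝ} (hf : Bounded f) : weightedExp ρ π P c f 0 = stepExp π ρ f := by
  have h : Bounded fun p : Fin 1 → S × A => f (p (Fin.last 0)) := hf.comp _
  simp only [weightedExp, Finset.univ_eq_empty, Finset.prod_empty, one_mul, pathPMF]
  rw [pexp_bind _ _ h, stepExp]
  congr 1
  funext s
  rw [pexp_map _ _ h]

theorem weightedExp_succ (ρ : PMF S) (π : S → PMF A) (P : S → A → PMF S) {c f : S × A → ℝ}
    (hc : Bounded c) (hf : Bounded f) (n : ℕ) :
    weightedExp ρ π P c f (n + 1) = weightedExp ρ π P c (backup π P c f) n := by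
  have h := bounded_path hc hf (n + 1)
  simp only [weightedExp, pathPMF]
  rw [pexp_bind _ _ h]
  congr 1
  funext p
  rw [pexp_bind _ _ h, backup, stepExp, ← mul_assoc, ← Fin.prod_univ_castSucc fun i => c (p i),
    ← pexp_const_mul]
  congr 1
  funext s
  rw [pexp_map _ _ h, ← pexp_const_mul]
  simp only [Fin.snoc_castSucc, Fin.snoc_last]

theorem sum_weightedExp (ρ : PMF S) (π : S → PMF A) (P : S → A → PMF S) (γ : ℝ)
    {c f : S × A → ℝ} (hc : Bounded c) (hf : Bounded f) (n : ℕ) :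
    ∑ t ∈ Finset.range n, γ ^ t * weightedExp ρ π P c f t =
      stepExp π ρ (qSum π P γ c f n) := by
  induction n generalizing f with
  | zero => simp [qSum, stepExp_const]
  | succ n ih =>
    have hL := hc.backup hf π P
    rw [Finset.sum_range_succ', funext (qSum_succ' hc hf π P γ n),
      stepExp_add π ρ hf ((Bounded.const γ).mul (hc.qSum hL π P γ n)), stepExp_const_mul,
      ← ih hL, weightedExp_zero ρ π P c hf, Finset.mul_sum, add_comm]
    congr 1
    · simp
    · refine Finset.sum_congr rfl fun t _ => ?_
      rw [weightedExp_succ ρ π P hc hf, pow_succ']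
      ring

theorem abs_qSum_le (π : S → PMF A) (P : S → A → PMF S) {γ R : ℝ} (hγ0 : 0 ≤ γ) (hγ1 : γ < 1)
    {f : S × A → ℝ} (hf : ∀ x, |f x| ≤ R) (n : ℕ) (x : S × A) :
    |qSum π P γ (fun _ => 1) f n x| ≤ R / (1 - γ) := by
  have h1 : 0 < 1 - γ := by linarith
  induction n generalizing x with
  | zero =>
    have := (abs_nonneg _).trans (hf x)
    simp only [qSum, abs_zero]
    positivity
  | succ n ih =>
    simp only [qSum, backup, one_mul]
    refine (abs_add_le _ _).trans ?_
    rw [abs_mul, abs_of_nonneg hγ0]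
    have := mul_le_mul_of_nonneg_left (abs_stepExp_le π (P x.1 x.2) ih) hγ0
    have e : R / (1 - γ) = R + γ * (R / (1 - γ)) := by field_simp; ring
    linarith [hf x]

theorem tendsto_sum_of_abs_le {γ : ℝ} (hγ0 : 0 ≤ γ) (hγ1 : γ < 1) {u : ℕ → ℝ} {C : ℝ}
    (hu : ∀ t, |u t| ≤ C) :
    Filter.Tendsto (fun n => ∑ t ∈ Finset.range n, γ ^ t * u t) Filter.atTop
      (nhds (∑' t, γ ^ t * u t)) := by
  refine (Summable.of_norm_bounded
    ((summable_geometric_of_lt_one hγ0 hγ1).mul_right C) fun t => ?_).hasSum.tendsto_sum_nat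
  rw [Real.norm_eq_abs, abs_mul, abs_of_nonneg (by positivity)]
  exact mul_le_mul_of_nonneg_left (hu t) (by positivity)

theorem tendsto_J (ρ : PMF S) (π : S → PMF A) (P : S → A → PMF S) {γ R : ℝ} (hγ0 : 0 ≤ γ)
    (hγ1 : γ < 1) {r : S → A → ℝ} (hr : ∀ s a, |r s a| ≤ R) :
    Filter.Tendsto (fun n => stepExp π ρ (qSum π P γ (fun _ => 1) (fun x => r x.1 x.2) n))
      Filter.atTop (nhds (J ρ π P γ r)) := by
  have hb : Bounded fun x : S × A => r x.1 x.2 := ⟨R, fun x => hr _ _⟩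
  refine (tendsto_sum_of_abs_le hγ0 hγ1 (C := R) fun t =>
    abs_pexp_le (saDist ρ π P t) fun x => hr x.1 x.2).congr fun n => ?_
  rw [← sum_weightedExp ρ π P γ (.const 1) hb]
  refine Finset.sum_congr rfl fun t _ => ?_
  rw [saDist, pexp_map _ _ hb, weightedExp]
  simp only [Finset.prod_const_one, one_mul]

/-- The real-valued indicator of a set. -/
noncomputable def ind {X : Type*} (V : Set X) (x : X) : ℝ := if x ∈ V then 1 else 0

theorem bounded_ind {X : Type*} (V : Set X) : Bounded (ind V) :=
  ⟨1, fun x => by by_cases hx : x ∈ V <;> simp [ind, hx]⟩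

theorem toReal_hitProb (ρ : PMF S) (π : S → PMF A) (P : S → A → PMF S) (V : Set (S × A))
    (t : ℕ) : (hitProb ρ π P V t).toReal = weightedExp ρ π P (ind Vᶜ) (ind V) t := by
  rw [hitProb, toReal_toOuterMeasure, weightedExp]
  congr 1
  funext p
  have e : (∀ i : Fin (t + 1), (i : ℕ) < t → p i ∉ V) ↔ ∀ i : Fin t, p i.castSucc ∉ V :=
    ⟨fun h i => h _ i.2, fun h i hi => h ⟨i, hi⟩⟩
  simp only [Set.mem_ofPred_eq, e, ind, Finset.prod_boole, Finset.mem_univ, true_imp_iff,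
    Set.mem_compl_iff]
  by_cases h1 : p (Fin.last t) ∈ V <;> simp [h1]

theorem tendsto_discHit (ρ : PMF S) (π : S → PMF A) (P : S → A → PMF S) {γ : ℝ} (hγ0 : 0 ≤ γ)
    (hγ1 : γ < 1) (V : Set (S × A)) :
    Filter.Tendsto (fun n => stepExp π ρ (qSum π P γ (ind Vᶜ) (ind V) n))
      Filter.atTop (nhds (discHit ρ π P γ V)) := by
  refine (tendsto_sum_of_abs_le hγ0 hγ1 (C := 1) (u := fun t => (hitProb ρ π P V t).toReal)
    fun t => ?_).congr fun n => ?_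
  · rw [hitProb, toReal_toOuterMeasure]
    exact abs_pexp_le _ fun x => by split_ifs <;> simp
  · simp only [toReal_hitProb]
    exact sum_weightedExp ρ π P γ (bounded_ind _) (bounded_ind _) n

theorem stepExp_map_some (π : S → PMF A) (a0 : PMF A) (μ : PMF S) {f : Option S × A → ℝ}
    (hf : Bounded f) :
    stepExp (extendPolicy π a0) (μ.map some) f = stepExp π μ fun x => f (some x.1, x.2) := by
  rw [stepExp, pexp_map _ _ (hf.pexp _)]
  rfl

theorem qSum_le_qSum_pess (P Phat : S → A → PMF S) {r : S → A → ℝ} {Rmax : ℝ}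
    (hR0 : 0 ≤ Rmax) (hR : ∀ s a, |r s a| ≤ Rmax) {γ : ℝ} (hγ0 : 0 ≤ γ) (hγ1 : γ < 1)
    {α : ℝ} (hα : 0 ≤ α) (π : S → PMF A) (a0 : PMF A) (n : ℕ) (x : S × A) :
    qSum π P γ (fun _ => 1) (fun x => r x.1 x.2) n x ≤
      qSum (extendPolicy π a0) (pessKernel Phat (unknown P Phat α)) γ (fun _ => 1)
        (fun x => pessReward r Rmax x.1 x.2) n (some x.1, x.2) +
      (2 * (Rmax / (1 - γ)) * (γ * α / (1 - γ)) + 2 * (Rmax / (1 - γ)) *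
        qSum π P γ (ind (unknown P Phat α)ᶜ) (ind (unknown P Phat α)) n x) := by
  have h1 : 0 < 1 - γ := by linarith
  set U := unknown P Phat α
  have hpr : ∀ y : Option S × A, |pessReward r Rmax y.1 y.2| ≤ Rmax := by
    rintro ⟨_ | s, a⟩
    · simp [pessReward, abs_of_nonneg hR0]
    · exact hR s a
  have hq := abs_qSum_le π P hγ0 hγ1 (f := fun x => r x.1 x.2) fun x => hR x.1 x.2
  have hqp := abs_qSum_le (extendPolicy π a0) (pessKernel Phat U) hγ0 hγ1 hpr
  set B := Rmax / (1 - γ)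
  have hB0 : 0 ≤ B := by positivity
  have hK : 0 ≤ 2 * B * (γ * α / (1 - γ)) := by positivity
  induction n generalizing x with
  | zero => simpa [qSum] using hK
  | succ n ih =>
    have hWb : Bounded (qSum π P γ (ind Uᶜ) (ind U) n) :=
      (bounded_ind _).qSum (bounded_ind _) π P γ n
    have hpx : pessReward r Rmax (some x.1) x.2 = r x.1 x.2 := rfl
    simp only [qSum, backup, one_mul, hpx]
    by_cases hx : x ∈ U
    · have e1 := (abs_le.1 (abs_stepExp_le π (P x.1 x.2) (hq n))).2
      have e2 := (abs_le.1 (abs_stepExp_le (extendPolicy π a0)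
        (pessKernel Phat U (some x.1) x.2) (hqp n))).1
      have i1 : ind U x = 1 := by simp [ind, hx]
      have i2 : ind Uᶜ x = 0 := by simp [ind, hx]
      rw [i1, i2]
      have e3 : γ * B ≤ B := mul_le_of_le_one_left hB0 hγ1.le
      have e4 := mul_le_mul_of_nonneg_left e1 hγ0
      have e5 := mul_le_mul_of_nonneg_left e2 hγ0
      linarith
    · have i1 : ind U x = 0 := by simp [ind, hx]
      have i2 : ind Uᶜ x = 1 := by simp [ind, hx]
      have hk : pessKernel Phat U (some x.1) x.2 = (Phat x.1 x.2).map some := by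
        simp [pessKernel, hx]
      have hd : DTV (Phat x.1 x.2) (P x.1 x.2) ≤ α := not_lt.1 hx
      rw [i1, i2, hk, stepExp_map_some π a0 _ ⟨B, hqp n⟩]
      have e1 := (abs_le.1 (abs_stepExp_sub_le π (Phat x.1 x.2) (P x.1 x.2)
        (f := fun y => qSum (extendPolicy π a0) (pessKernel Phat U) γ (fun _ => 1)
          (fun x => pessReward r Rmax x.1 x.2) n (some y.1, y.2)) fun y => hqp n _)).1
      have e2 := stepExp_mono π (P x.1 x.2) ⟨B, hq n⟩
        (Bounded.add (Bounded.comp ⟨B, hqp n⟩ fun y : S × A => (some y.1, y.2))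
          ((Bounded.const _).add ((Bounded.const _).mul hWb))) ih
      rw [stepExp_add π _ (Bounded.comp ⟨B, hqp n⟩ fun y : S × A => (some y.1, y.2))
          ((Bounded.const _).add ((Bounded.const _).mul hWb)),
        stepExp_add π _ (.const _) ((Bounded.const _).mul hWb), stepExp_const,
        stepExp_const_mul] at e2
      have e3 : 2 * B * DTV (Phat x.1 x.2) (P x.1 x.2) ≤ 2 * B * α :=
        mul_le_mul_of_nonneg_left hd (by positivity)
      have e4 : 2 * B * (γ * α / (1 - γ)) =
          γ * (2 * B * α + 2 * B * (γ * α / (1 - γ))) := by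
        field_simp; ring
      rw [e4]
      have e5 := mul_le_mul_of_nonneg_left e2 hγ0
      have e6 := mul_le_mul_of_nonneg_left ((neg_le_neg e3).trans e1) hγ0
      linarith

end Backup

/-- **Theorem 1 (lower bound).** For any policy, the value in the `(α, Rmax)`-pessimistic MDP
approximately lower-bounds the value in the true MDP. -/
theorem pessimistic_value_lower_bound
    {S : Type u} {A : Type v} [Countable S] [Countable A]
    (P Phat : S → A → PMF S) (ρ0 ρhat : PMF S)
    (r : S → A → ℝ) (Rmax : ℝ) (hR : ∀ s a, |r s a| ≤ Rmax)
    (γ : ℝ) (hγ0 : 0 ≤ γ) (hγ1 : γ < 1)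
    (α : ℝ) (hα : 0 ≤ α)
    (π : S → PMF A) (a0 : PMF A) :
    J ρ0 π P γ r
        - (2 * Rmax / (1 - γ)) * DTV ρ0 ρhat
        - (2 * γ * Rmax / (1 - γ) ^ 2) * α
        - (2 * Rmax / (1 - γ)) * discHit ρ0 π P γ (unknown P Phat α)
      ≤ J (ρhat.map some) (extendPolicy π a0)
          (pessKernel Phat (unknown P Phat α)) γ (pessReward r Rmax) := by
  obtain ⟨s, -⟩ := ρ0.support_nonempty
  obtain ⟨a, -⟩ := a0.support_nonempty
  have hR0 : 0 ≤ Rmax := (abs_nonneg _).trans (hR s a)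
  have hpr : ∀ s a, |pessReward r Rmax s a| ≤ Rmax := by
    rintro (_ | s) a
    · simp [pessReward, abs_of_nonneg hR0]
    · exact hR s a
  refine le_of_tendsto_of_tendsto'
    ((((tendsto_J ρ0 π P hγ0 hγ1 hR).sub_const _).sub_const _).sub
      ((tendsto_discHit ρ0 π P hγ0 hγ1 (unknown P Phat α)).const_mul _))
    (tendsto_J (ρhat.map some) (extendPolicy π a0) (pessKernel Phat (unknown P Phat α))
      hγ0 hγ1 hpr) fun n => ?_
  have hq := abs_qSum_le π P hγ0 hγ1 (f := fun x => r x.1 x.2) (fun x => hR x.1 x.2) n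
  have hqp := abs_qSum_le (extendPolicy π a0) (pessKernel Phat (unknown P Phat α)) hγ0 hγ1
    (f := fun x => pessReward r Rmax x.1 x.2) (fun x => hpr x.1 x.2) n
  have hWb : Bounded (qSum π P γ (ind (unknown P Phat α)ᶜ) (ind (unknown P Phat α)) n) :=
    (bounded_ind _).qSum (bounded_ind _) π P γ n
  have hqs := Bounded.comp ⟨_, hqp⟩ fun y : S × A => (some y.1, y.2)
  have e1 := stepExp_mono π ρ0 ⟨_, hq⟩
    (hqs.add ((Bounded.const _).add ((Bounded.const _).mul hWb)))
    (qSum_le_qSum_pess P Phat hR0 hR hγ0 hγ1 hα π a0 n)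
  rw [stepExp_add π _ hqs ((Bounded.const _).add ((Bounded.const _).mul hWb)),
    stepExp_add π _ (.const _) ((Bounded.const _).mul hWb), stepExp_const,
    stepExp_const_mul] at e1
  have e2 := (abs_le.1 (abs_stepExp_sub_le π ρ0 ρhat fun y => hqp (some y.1, y.2))).2
  rw [stepExp_map_some π a0 _ ⟨_, hqp⟩]
  have c1 : 2 * Rmax / (1 - γ) = 2 * (Rmax / (1 - γ)) := mul_div_assoc _ _ _
  have c2 : 2 * γ * Rmax / (1 - γ) ^ 2 * α =
      2 * (Rmax / (1 - γ)) * (γ * α / (1 - γ)) := by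
    have h1 : 1 - γ ≠ 0 := by linarith
    field_simp
  rw [c1, c2]
  linarith

end MOReL
end

section
/- (Lemma 2: hitting time and visitation distribution.) Let M be an MDP with discount γ ∈ [0,1). For any set of state-action pairs V ⊆ S × A and any policy π, the hitting time T_V^π of V by π on M satisfies E[γ^{T_V^π}] ≤ d^{π,M}(V)/(1−γ). -/
open scoped ENNReal NNReal
open Classical

namespace MOReL

theorem hitProb_le_saDist (ρ0 : PMF S) (π : S → PMF A) (P : S → A → PMF S)
    (V : Set (S × A)) (t : ℕ) :
    hitProb ρ0 π P V t ≤ ∑' sa : V, saDist ρ0 π P t sa := by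
  rw [tsum_subtype V (saDist ρ0 π P t), ← PMF.toOuterMeasure_apply, saDist,
    PMF.toOuterMeasure_map_apply]
  exact MeasureTheory.OuterMeasure.mono _ fun p hp => hp.1

theorem tsum_subtype_pmf_le_one {α : Type*} (p : PMF α) (V : Set α) : ∑' x : V, p x ≤ 1 :=
  (ENNReal.tsum_comp_le_tsum_of_injective Subtype.val_injective p).trans p.tsum_coe.le

/-- **Lemma 2.** `E[γ^{T_V^π}] ≤ d^{π,M}(V) / (1 - γ)`. -/
theorem discHit_le_visitation
    {S : Type u} {A : Type v} [Countable S] [Countable A]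
    (ρ0 : PMF S) (π : S → PMF A) (P : S → A → PMF S)
    (γ : ℝ) (hγ0 : 0 ≤ γ) (hγ1 : γ < 1)
    (V : Set (S × A)) :
    discHit ρ0 π P γ V ≤ dVisitSet ρ0 π P γ V / (1 - γ) := by
  let q : ℕ → V → ℝ := fun t sa => (saDist ρ0 π P t sa).toReal
  have hne (t : ℕ) : ∑' sa : V, saDist ρ0 π P t sa ≠ ⊤ :=
    ne_top_of_le_ne_top ENNReal.one_ne_top (tsum_subtype_pmf_le_one _ V)
  have hqs (t : ℕ) : Summable (q t) := ENNReal.summable_toReal (hne t)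
  have hqt (t : ℕ) : ∑' sa, q t sa = (∑' sa : V, saDist ρ0 π P t sa).toReal :=
    (ENNReal.tsum_toReal_eq fun sa => PMF.apply_ne_top _ _).symm
  have hq1 (t : ℕ) : ∑' sa, q t sa ≤ 1 := by
    rw [hqt]
    exact ENNReal.toReal_le_of_le_ofReal zero_le_one
      (by simpa using tsum_subtype_pmf_le_one (saDist ρ0 π P t) V)
  have hq0 (t : ℕ) (sa : V) : 0 ≤ q t sa := ENNReal.toReal_nonneg
  have hsum : Summable fun t => γ ^ t * ∑' sa, q t sa :=
    Summable.of_nonneg_of_le (fun t => mul_nonneg (pow_nonneg hγ0 t) (tsum_nonneg (hq0 t)))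
      (fun t => mul_le_of_le_one_right (pow_nonneg hγ0 t) (hq1 t))
      (summable_geometric_of_lt_one hγ0 hγ1)
  have hjoint : Summable (Function.uncurry fun t sa => γ ^ t * q t sa) := by
    have hnonneg : 0 ≤ Function.uncurry fun t sa => γ ^ t * q t sa :=
      fun x => mul_nonneg (pow_nonneg hγ0 x.1) (hq0 x.1 x.2)
    refine (summable_prod_of_nonneg hnonneg).2 ⟨fun t => (hqs t).mul_left (γ ^ t), ?_⟩
    simpa only [Function.uncurry_apply_pair, tsum_mul_left] using hsum
  have hvisit : dVisitSet ρ0 π P γ V / (1 - γ) = ∑' t, γ ^ t * ∑' sa, q t sa := by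
    have hcomm : ∑' sa, ∑' t, γ ^ t * q t sa = ∑' t, ∑' sa, γ ^ t * q t sa :=
      Summable.tsum_comm hjoint
    have hd : dVisitSet ρ0 π P γ V = (1 - γ) * ∑' sa, ∑' t, γ ^ t * q t sa := tsum_mul_left
    rw [hd, mul_div_cancel_left₀ _ (sub_pos.2 hγ1).ne', hcomm]
    exact tsum_congr fun t => tsum_mul_left
  have hle (t : ℕ) : γ ^ t * (hitProb ρ0 π P V t).toReal ≤ γ ^ t * ∑' sa, q t sa := by
    rw [hqt]
    exact mul_le_mul_of_nonneg_left
      (ENNReal.toReal_mono (hne t) (hitProb_le_saDist ρ0 π P V t)) (pow_nonneg hγ0 t)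
  rw [hvisit, discHit]
  exact (Summable.of_nonneg_of_le
    (fun t => mul_nonneg (pow_nonneg hγ0 t) ENNReal.toReal_nonneg) hle hsum).tsum_le_tsum hle hsum

end MOReL
end

section
/- (Proposition 1: minimax lower bound for offline RL.) For any discount factor γ ∈ [0.95, 1), support mismatch ε ∈ (0, (1−γ)/log(1/(1−γ))], and reward range [−Rmax, Rmax], there exist a finite MDP M, a starting state distribution ρ0, an optimal policy π* for M, and a behavior (data collection) policy π_b such that: (i) d^{π*,M}(U_D) ≤ ε, where U_D is the set of state-action pairs not occurring in any dataset D of trajectories collected by executing π_b in M; and (ii) any policy π̂ that is a function solely of the dataset collected with π_b satisfies J_{ρ0}(π*, M) − J_{ρ0}(π̂, M) ≥ (Rmax/(4·(1−γ)²))·(ε/log(1/(1−γ))). -/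
open scoped ENNReal NNReal
open Classical MeasureTheory

namespace MOReL

universe u v

variable {S : Type u} {A : Type v}

/-- The geometric distribution `t ↦ (1-γ)γ^t` on `ℕ`. -/
noncomputable def geomPMF (γ : ℝ) (h0 : 0 ≤ γ) (h1 : γ < 1) : PMF ℕ :=
  ⟨fun t => ENNReal.ofReal ((1 - γ) * γ ^ t), by
    have hsum : Summable fun t : ℕ => (1 - γ) * γ ^ t :=
      (summable_geometric_of_lt_one h0 h1).mul_left _
    have h : (∑' t : ℕ, ENNReal.ofReal ((1 - γ) * γ ^ t)) = 1 := by
      rw [← ENNReal.ofReal_tsum_of_nonneg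
        (fun t => mul_nonneg (by linarith) (pow_nonneg h0 t)) hsum]
      rw [tsum_mul_left, tsum_geometric_of_lt_one h0 h1,
        mul_inv_cancel₀ (by linarith : (1 : ℝ) - γ ≠ 0)]
      simp
    rw [← h]
    exact ENNReal.summable.hasSum⟩

/-- The discounted state-action visitation distribution `d^{π,M}` as a PMF: sample a
geometric time `t` and then `(s_t, a_t)`. -/
noncomputable def visitPMF (ρ0 : PMF S) (π : S → PMF A) (P : S → A → PMF S)
    (γ : ℝ) (h0 : 0 ≤ γ) (h1 : γ < 1) : PMF (S × A) :=
  (geomPMF γ h0 h1).bind (saDist ρ0 π P)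

/-- The empirical distribution of `n` sample points. -/
noncomputable def empPMF {α : Type*} {n : ℕ} (hn : 0 < n) (X : Fin n → α) : PMF α :=
  PMF.ofMultiset (Multiset.map X Finset.univ.val) (by
    intro h
    have hc := congrArg Multiset.card h
    simp at hc
    omega)

/-- The distribution of a single data point `(s₀, (s, a, s'))` obtained from a trajectory of
the behavior policy `π` : the initial state `s₀ ∼ ρ0`, a state-action pair `(s,a)` drawn
from the discounted visitation distribution of `π`, and a next state `s' ∼ P(·|s,a)`. -/
noncomputable def sampleDist (ρ0 : PMF S) (π : S → PMF A) (P : S → A → PMF S)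
    (γ : ℝ) (h0 : 0 ≤ γ) (h1 : γ < 1) : PMF (S × S × A × S) :=
  ρ0.bind fun s0 => (visitPMF ρ0 π P γ h0 h1).bind fun sa =>
    (P sa.1 sa.2).map fun s' => (s0, sa.1, sa.2, s')

variable [DecidableEq S] [DecidableEq A]

/-- `n_{(s,a)}`: the number of occurrences of the state-action pair `(s,a)` in the dataset. -/
noncomputable def countSA {n : ℕ} (D : Fin n → S × S × A × S) (sa : S × A) : ℕ :=
  (Finset.univ.filter fun i => ((D i).2.1, (D i).2.2.1) = sa).card

/-- The empirical initial-state distribution `ρ̂0` computed from the dataset. -/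
noncomputable def empInit {n : ℕ} (hn : 0 < n) (D : Fin n → S × S × A × S) : PMF S :=
  empPMF hn fun i => (D i).1

/-- The empirical transition kernel `P̂(·|s,a)` computed from the dataset (an arbitrary
distribution if `(s,a)` does not occur in the dataset). -/
noncomputable def empKernel [Nonempty S] {n : ℕ} (D : Fin n → S × S × A × S) :
    S → A → PMF S := fun s a =>
  let m : Multiset S :=
    (Finset.univ.val.map fun i : Fin n => (D i).2).filterMap
      fun x => if (x.1, x.2.1) = (s, a) then some x.2.2 else none
  if h : m = 0 then PMF.pure (Classical.arbitrary S) else PMF.ofMultiset m h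

end MOReL

namespace MOReL

section Paths

variable {S : Type*} {A : Type*}

theorem saDist_zero (ρ0 : PMF S) (π : S → PMF A) (P : S → A → PMF S) :
    saDist ρ0 π P 0 = ρ0.bind fun s => (π s).map (Prod.mk s) := by
  simp only [saDist, pathPMF, PMF.map_bind, PMF.map_comp]
  rfl

theorem saDist_succ (ρ0 : PMF S) (π : S → PMF A) (P : S → A → PMF S) (t : ℕ) :
    saDist ρ0 π P (t + 1) = (saDist ρ0 π P t).bind fun sa =>
      (P sa.1 sa.2).bind fun s => (π s).map (Prod.mk s) := by
  simp only [saDist, pathPMF, PMF.map_bind, PMF.map_comp, PMF.bind_map]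
  congr 1
  funext p
  simp only [Function.comp_apply]
  congr 1
  funext s
  congr 1
  funext a
  simp

/-- For deterministic dynamics that are absorbed after one step, the state-action
distribution is stationary from time `1` on. -/
theorem saDist_succ_of_absorbed (ρ0 : PMF S) (π : S → PMF A) (f : S → A → S)
    (hf : ∀ s a a', f (f s a) a' = f s a) (t : ℕ) :
    saDist ρ0 π (fun s a => PMF.pure (f s a)) (t + 1) =
      (ρ0.bind fun s => (π s).map (f s)).bind fun s => (π s).map (Prod.mk s) := by
  induction t with
  | zero =>
    rw [saDist_succ, saDist_zero]
    simp [PMF.bind_bind, PMF.bind_map, Function.comp_def]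
  | succ t ih =>
    rw [saDist_succ, ih]
    simp [PMF.bind_bind, PMF.bind_map, Function.comp_def, hf]

theorem bind_map_mk_apply (σ : PMF S) (π : S → PMF A) (s : S) (a : A) :
    (σ.bind fun s => (π s).map (Prod.mk s)) (s, a) = σ s * π s a := by
  rw [PMF.bind_apply, tsum_eq_single s]
  · congr 1
    rw [PMF.map_apply, tsum_eq_single a]
    · simp
    · intro a' h
      simp [h.symm]
  · intro s' h
    rw [PMF.map_apply]
    simp [h.symm]

theorem pexp_bind_map_mk [Fintype S] [Fintype A] (σ : PMF S) (π : S → PMF A) (g : S → ℝ) :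
    pexp (σ.bind fun s => (π s).map (Prod.mk s)) (fun sa => g sa.1) = pexp σ g := by
  have hsum (s : S) : ∑ a, (π s a).toReal = 1 := by
    rw [← ENNReal.toReal_sum fun a _ => (π s).apply_ne_top a, ← tsum_fintype (L := .unconditional _),
      PMF.tsum_coe, ENNReal.toReal_one]
  simp only [pexp, tsum_fintype, Fintype.sum_prod_type, bind_map_mk_apply, ENNReal.toReal_mul]
  refine Finset.sum_congr rfl fun s _ => ?_
  rw [← Finset.sum_mul, ← Finset.mul_sum, hsum, mul_one]

end Paths

/-- Transitions of the hard instance: from the initial state `none`, only the action `some b`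
leads to the good absorbing state `some true`, the other actions to the bad absorbing state
`some false`. -/
def hardStep (b : Bool) : Option Bool → Option Bool → Option Bool
  | none, some c => some (c == b)
  | none, none => some false
  | some s, _ => some s

/-- The reward of the hard instance is `R` in the good state and `0` elsewhere. -/
def hardReward (R : ℝ) : Option Bool → ℝ
  | some true => R
  | _ => 0

/-- The transition kernel of the hard instance. -/
noncomputable def hardKernel (b : Bool) (s a : Option Bool) : PMF (Option Bool) :=
  PMF.pure (hardStep b s a)

/-- The optimal policy of the hard instance. -/
noncomputable def hardOptimal (b : Bool) : Option Bool → PMF (Option Bool)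
  | none => PMF.pure (some b)
  | some _ => PMF.pure none

/-- The initial distribution of the hard instance: the state `none` with probability `q`, and
the good state otherwise. -/
noncomputable def hardInit (q : ℝ≥0) (hq : q ≤ 1) : PMF (Option Bool) :=
  PMF.ofFintype
    (fun s => match s with
      | none => q
      | some true => ((1 - q : ℝ≥0) : ℝ≥0∞)
      | some false => 0)
    (by
      simp only [Fintype.sum_option, Fintype.sum_bool, add_zero]
      rw [← ENNReal.coe_add, add_tsub_cancel_of_le hq, ENNReal.coe_one])

section HardInstance

variable (q : ℝ≥0) (hq : q ≤ 1)

theorem hardInit_none : hardInit q hq none = q := rfl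

theorem hardInit_good : hardInit q hq (some true) = ((1 - q : ℝ≥0) : ℝ≥0∞) := rfl

theorem hardInit_bad : hardInit q hq (some false) = 0 := rfl

theorem hardStep_absorbed (b : Bool) (s a a' : Option Bool) :
    hardStep b (hardStep b s a) a' = hardStep b s a := by
  rcases s with _ | s <;> rcases a with _ | a <;> rfl

/-- The state distribution of the hard instance from time `1` on. -/
noncomputable def hardNext (b : Bool) (π : Option Bool → PMF (Option Bool)) :
    PMF (Option Bool) :=
  (hardInit q hq).bind fun s => (π s).map (hardStep b s)

theorem saDist_hard_succ (b : Bool) (π : Option Bool → PMF (Option Bool)) (t : ℕ) :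
    saDist (hardInit q hq) π (hardKernel b) (t + 1) =
      (hardNext q hq b π).bind fun s => (π s).map (Prod.mk s) :=
  saDist_succ_of_absorbed _ π (hardStep b) (hardStep_absorbed b) t

theorem hardNext_none (b : Bool) (π : Option Bool → PMF (Option Bool)) :
    hardNext q hq b π none = 0 := by
  simp [hardNext, PMF.bind_apply, PMF.map_apply, tsum_fintype, Fintype.sum_option, hardStep]

theorem hardNext_good (b : Bool) (π : Option Bool → PMF (Option Bool)) :
    hardNext q hq b π (some true) =
      q * π none (some b) + ((1 - q : ℝ≥0) : ℝ≥0∞) := by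
  have h1 : π (some true) none + (π (some true) (some true) + π (some true) (some false)) = 1 := by
    have := (π (some true)).tsum_coe
    simpa [tsum_fintype, Fintype.sum_option] using this
  cases b <;>
  simp [hardNext, PMF.bind_apply, PMF.map_apply, tsum_fintype, Fintype.sum_option, hardStep,
    hardInit_none, hardInit_good, hardInit_bad, h1]

theorem pexp_hardReward (σ : PMF (Option Bool)) (R : ℝ) :
    pexp σ (hardReward R) = (σ (some true)).toReal * R := by
  simp [pexp, tsum_fintype, Fintype.sum_option, hardReward]

theorem J_hard (γ : ℝ) (h0 : 0 ≤ γ) (h1 : γ < 1) (R : ℝ) (b : Bool)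
    (π : Option Bool → PMF (Option Bool)) :
    J (hardInit q hq) π (hardKernel b) γ (fun s _ => hardReward R s) =
      (1 - q) * R +
        γ / (1 - γ) * ((q * (π none (some b)).toReal + (1 - q)) * R) := by
  have hg : ((hardNext q hq b π) (some true)).toReal =
      q * (π none (some b)).toReal + (1 - q) := by
    rw [hardNext_good, ENNReal.toReal_add
      (ENNReal.mul_ne_top ENNReal.coe_ne_top ((π none).apply_ne_top _)) ENNReal.coe_ne_top]
    rw [ENNReal.toReal_mul, ENNReal.coe_toReal, ENNReal.coe_toReal, NNReal.coe_sub hq,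
      NNReal.coe_one]
  have h_succ (t : ℕ) : γ ^ (t + 1) * pexp (saDist (hardInit q hq) π (hardKernel b) (t + 1))
      (fun sa => hardReward R sa.1) =
      γ ^ t * (γ * ((q * (π none (some b)).toReal + (1 - q)) * R)) := by
    rw [saDist_hard_succ, pexp_bind_map_mk, pexp_hardReward, hg]
    ring
  rw [J, ((summable_nat_add_iff 1).1 ?_).tsum_eq_zero_add]
  · simp only [h_succ]
    rw [tsum_mul_right, tsum_geometric_of_lt_one h0 h1, saDist_zero, pexp_bind_map_mk,
      pexp_hardReward, hardInit_good, ENNReal.coe_toReal, NNReal.coe_sub hq]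
    simp
    ring
  · simp only [h_succ]
    exact (summable_geometric_of_lt_one h0 h1).mul_right _

theorem hardNext_pure_none (b b' : Bool) :
    hardNext q hq b (fun _ => PMF.pure none) = hardNext q hq b' (fun _ => PMF.pure none) := by
  simp only [hardNext, PMF.pure_map]
  congr 1
  funext s
  cases s <;> rfl

theorem visitPMF_hard_eq (γ : ℝ) (h0 : 0 ≤ γ) (h1 : γ < 1) (b b' : Bool) :
    visitPMF (hardInit q hq) (fun _ => PMF.pure none) (hardKernel b) γ h0 h1 =
      visitPMF (hardInit q hq) (fun _ => PMF.pure none) (hardKernel b') γ h0 h1 := by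
  rw [visitPMF, visitPMF]
  congr 1
  funext t
  cases t with
  | zero => rw [saDist_zero, saDist_zero]
  | succ t => rw [saDist_hard_succ, saDist_hard_succ, hardNext_pure_none q hq b b']

theorem saDist_eq_zero_of_visitPMF_eq_zero {S A : Type*} {ρ0 : PMF S} {π : S → PMF A}
    {P : S → A → PMF S} {γ : ℝ} {h0 : 0 < γ} {h1 : γ < 1} {sa : S × A}
    (h : visitPMF ρ0 π P γ h0.le h1 sa = 0) (t : ℕ) : saDist ρ0 π P t sa = 0 := by
  rw [visitPMF, PMF.bind_apply, ENNReal.tsum_eq_zero] at h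
  refine (mul_eq_zero.1 (h t)).resolve_left ?_
  have : 0 < (1 - γ) * γ ^ t := mul_pos (by linarith) (pow_pos h0 t)
  exact (ENNReal.ofReal_pos.2 this).ne'

theorem visitPMF_hard_action (γ : ℝ) (h0 : 0 ≤ γ) (h1 : γ < 1) (b : Bool) (s : Option Bool)
    (c : Bool) :
    visitPMF (hardInit q hq) (fun _ => PMF.pure none) (hardKernel b) γ h0 h1 (s, some c) = 0 := by
  rw [visitPMF, PMF.bind_apply, ENNReal.tsum_eq_zero]
  rintro (_ | t)
  · rw [saDist_zero, bind_map_mk_apply]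
    simp
  · rw [saDist_hard_succ, bind_map_mk_apply]
    simp

theorem visitPMF_hard_good (hq' : q < 1) (γ : ℝ) (h0 : 0 < γ) (h1 : γ < 1) (b : Bool) :
    visitPMF (hardInit q hq) (fun _ => PMF.pure none) (hardKernel b) γ h0.le h1
      (some true, none) ≠ 0 := by
  intro h
  have := saDist_eq_zero_of_visitPMF_eq_zero (h0 := h0) h 0
  rw [saDist_zero, bind_map_mk_apply, hardInit_good] at this
  simp only [PMF.pure_apply_self, mul_one, ENNReal.coe_eq_zero] at this
  exact absurd hq' (tsub_eq_zero_iff_le.1 this).not_gt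

theorem hardNext_optimal_bad (b : Bool) :
    hardNext q hq b (hardOptimal b) (some false) = 0 := by
  simp [hardNext, PMF.bind_apply, PMF.map_apply, tsum_fintype, Fintype.sum_option, hardStep,
    hardInit_bad, hardOptimal]

theorem dVisit_hardOptimal_eq_zero (γ : ℝ) (b : Bool) (sa : Option Bool × Option Bool)
    (h1 : sa ≠ (none, some b)) (h2 : sa ≠ (some true, none)) :
    dVisit (hardInit q hq) (hardOptimal b) (hardKernel b) γ sa = 0 := by
  obtain ⟨s, a⟩ := sa
  have hs (t : ℕ) : saDist (hardInit q hq) (hardOptimal b) (hardKernel b) t (s, a) = 0 := by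
    cases t with
    | zero =>
      rw [saDist_zero, bind_map_mk_apply]
      rcases s with _ | _ | _ <;> simp_all [hardOptimal, hardInit_bad]
    | succ t =>
      rw [saDist_hard_succ, bind_map_mk_apply]
      rcases s with _ | _ | _ <;> simp_all [hardOptimal, hardNext_optimal_bad]
  simp [dVisit, hs]

theorem dVisit_hardOptimal_start (γ : ℝ) (b : Bool) :
    dVisit (hardInit q hq) (hardOptimal b) (hardKernel b) γ (none, some b) = (1 - γ) * q := by
  rw [dVisit, tsum_eq_single 0]
  · rw [saDist_zero, bind_map_mk_apply, hardInit_none]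
    simp [hardOptimal]
  · rintro (_ | t) ht
    · exact absurd rfl ht
    · rw [saDist_hard_succ, bind_map_mk_apply, hardNext_none]
      simp

theorem dVisitSet_hardOptimal_le (γ : ℝ) (h1 : γ < 1) (b : Bool)
    (V : Set (Option Bool × Option Bool)) (hV : (some true, none) ∉ V) :
    dVisitSet (hardInit q hq) (hardOptimal b) (hardKernel b) γ V ≤ (1 - γ) * q := by
  rw [dVisitSet]
  by_cases h : (none, some b) ∈ V
  · rw [tsum_eq_single ⟨_, h⟩, dVisit_hardOptimal_start]
    rintro ⟨sa, hsa⟩ hne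
    refine dVisit_hardOptimal_eq_zero q hq γ b sa (fun e => hne (Subtype.ext e)) ?_
    rintro rfl
    exact hV hsa
  · have (sa : V) : dVisit (hardInit q hq) (hardOptimal b) (hardKernel b) γ sa = 0 := by
      refine dVisit_hardOptimal_eq_zero q hq γ b sa ?_ ?_
      · intro e
        exact h (e ▸ sa.2)
      · intro e
        exact hV (e ▸ sa.2)
    simp only [this, tsum_zero]
    exact mul_nonneg (by linarith) q.2

end HardInstance

theorem exists_action_le_half (p : PMF (Option Bool)) :
    ∃ b : Bool, (p (some b)).toReal ≤ 1 / 2 := by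
  by_contra! h
  have h1 : p none + (p (some true) + p (some false)) = 1 := by
    simpa [tsum_fintype, Fintype.sum_option] using p.tsum_coe
  have h2 := congrArg ENNReal.toReal h1
  rw [ENNReal.toReal_add (p.apply_ne_top _)
    (ENNReal.add_ne_top.2 ⟨p.apply_ne_top _, p.apply_ne_top _⟩),
    ENNReal.toReal_add (p.apply_ne_top _) (p.apply_ne_top _), ENNReal.toReal_one] at h2
  have := (p none).toReal_nonneg
  linarith [h true, h false]

theorem one_lt_log_one_div_one_sub {γ : ℝ} (hγ1 : 0.95 ≤ γ) (hγ2 : γ < 1) :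
    1 < Real.log (1 / (1 - γ)) := by
  have hpos : 0 < 1 - γ := by linarith
  rw [Real.lt_log_iff_exp_lt (by positivity), lt_div_iff₀ hpos]
  have := Real.exp_one_lt_d9
  have := Real.exp_pos 1
  nlinarith

/-- **Proposition 1: minimax lower bound for offline RL.** For any `γ ∈ [0.95, 1)`,
support mismatch `ε`, and reward scale `Rmax`, there are a finite MDP skeleton
(state/action spaces, initial distribution), a behavior policy `π_b`, and a dataset
`Dset` (the tuples `(s, a, r(s,a), s')` reachable by `π_b`), such that for every policy
`π̂` (which, being a function solely of the fixed dataset, is independent of the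
adversarial choice below) there is an MDP `(P, r)` consistent with the dataset, with an
optimal policy `π*` placing at most `ε` discounted visitation on the unseen pairs `U_D`,
on which `π̂` is at least `(Rmax/(4(1-γ)²))·(ε/log(1/(1-γ)))` suboptimal. -/
theorem offline_rl_minimax_lower_bound
    (γ : ℝ) (hγ1 : 0.95 ≤ γ) (hγ2 : γ < 1)
    (ε : ℝ) (hε0 : 0 < ε) (hε1 : ε ≤ (1 - γ) / Real.log (1 / (1 - γ)))
    (Rmax : ℝ) (hRmax : 0 < Rmax) :
    ∃ (S A : Type) (_ : Fintype S) (_ : Fintype A)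
      (ρ0 : PMF S) (πb : S → PMF A) (Dset : Set (S × A × ℝ × S)),
      ∀ πhat : S → PMF A,
        ∃ (P : S → A → PMF S) (r : S → A → ℝ) (πstar : S → PMF A),
          (∀ s a, |r s a| ≤ Rmax) ∧
          (Dset = {x : S × A × ℝ × S |
              visitPMF ρ0 πb P γ (by linarith) hγ2 (x.1, x.2.1) ≠ 0 ∧
              x.2.2.1 = r x.1 x.2.1 ∧ P x.1 x.2.1 x.2.2.2 ≠ 0}) ∧
          (∀ π : S → PMF A, J ρ0 π P γ r ≤ J ρ0 πstar P γ r) ∧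
          dVisitSet ρ0 πstar P γ
              {sa : S × A | ¬ ∃ rr s', (sa.1, sa.2, rr, s') ∈ Dset} ≤ ε ∧
          (Rmax / (4 * (1 - γ) ^ 2)) * (ε / Real.log (1 / (1 - γ)))
            ≤ J ρ0 πstar P γ r - J ρ0 πhat P γ r := by
  have h0 : 0 < γ := by linarith
  have hpos : 0 < 1 - γ := by linarith
  have hL := one_lt_log_one_div_one_sub hγ1 hγ2
  set L := Real.log (1 / (1 - γ))
  have hL0 : 0 < L := by linarith
  have hεγ : ε < 1 - γ := hε1.trans_lt (div_lt_self hpos hL)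
  obtain ⟨q, hqε⟩ : ∃ q : ℝ≥0, (q : ℝ) = ε / (1 - γ) := ⟨⟨ε / (1 - γ), by positivity⟩, rfl⟩
  have hq1 : q < 1 := by
    rw [← NNReal.coe_lt_coe, hqε, NNReal.coe_one, div_lt_one hpos]
    exact hεγ
  have hq := hq1.le
  refine ⟨Option Bool, Option Bool, inferInstance, inferInstance, hardInit q hq,
    fun _ => PMF.pure none,
    {x | visitPMF (hardInit q hq) (fun _ => PMF.pure none) (hardKernel true) γ h0.le hγ2
        (x.1, x.2.1) ≠ 0 ∧ x.2.2.1 = hardReward Rmax x.1 ∧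
        hardKernel true x.1 x.2.1 x.2.2.2 ≠ 0}, fun πhat => ?_⟩
  obtain ⟨b, hb⟩ := exists_action_le_half (πhat none)
  have hopt : (hardOptimal b none (some b)).toReal = 1 := by simp [hardOptimal]
  refine ⟨hardKernel b, fun s _ => hardReward Rmax s, hardOptimal b, ?_, ?_, ?_, ?_, ?_⟩
  · rintro (_ | _ | _) _ <;> simp [hardReward, abs_of_pos hRmax, hRmax.le]
  · ext ⟨s, a, x, s'⟩
    simp only [Set.mem_ofPred_eq, visitPMF_hard_eq q hq γ h0.le hγ2 true b]
    rcases a with _ | c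
    · have : hardKernel true s none = hardKernel b s none := by cases s <;> rfl
      rw [this]
    · simp [visitPMF_hard_action]
  · intro π
    rw [J_hard q hq γ h0.le hγ2, J_hard q hq γ h0.le hγ2, hopt]
    have : (π none (some b)).toReal ≤ 1 :=
      ENNReal.toReal_le_of_le_ofReal zero_le_one (by simpa using (π none).coe_le_one _)
    gcongr
  · refine (dVisitSet_hardOptimal_le q hq γ hγ2 b _ ?_).trans_eq ?_
    · rw [Set.mem_ofPred_eq, not_not]
      exact ⟨Rmax, some true, visitPMF_hard_good q hq hq1 γ h0 hγ2 true, rfl, by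
        simp [hardKernel, hardStep]⟩
    · rw [hqε]
      field_simp
  · rw [J_hard q hq γ h0.le hγ2, J_hard q hq γ h0.le hγ2, hopt, hqε]
    set p := (πhat none (some b)).toReal
    calc Rmax / (4 * (1 - γ) ^ 2) * (ε / L)
        ≤ Rmax / (4 * (1 - γ) ^ 2) * ε := by
          gcongr
          exact div_le_self hε0.le hL.le
      _ = ε * Rmax / (1 - γ) ^ 2 * (1 / 4) := by field_simp
      _ ≤ ε * Rmax / (1 - γ) ^ 2 * (γ * (1 - p)) := by
          gcongr
          nlinarith
      _ = _ := by
          field_simp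
          ring

end MOReL
end
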